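/- If sup T = b_k < ∞, then for all q₁, q₂ ∈ (0,1) with q₁ < q₂, the difference μ_{q₂}(x) − μ_{q₁}(x) converges to (σ/ρ)·(Φ⁻¹(q₂) − Φ⁻¹(q₁)) as x → ∞. -/

import Mathlib

open MeasureTheory ProbabilityTheory Set Filter Topology

noncomputable def stdphi (x : ℝ) : ℝ := Real.exp (-(x ^ 2) / 2) / Real.sqrt (2 * Real.pi)

noncomputable def stdPhi (x : ℝ) : ℝ := ∫ t in Iic x, stdphi t

noncomputable def stdPhiInv : ℝ → ℝ := Function.invFun stdPhi

noncomputable def stdPhiE (c : EReal) (x s : ℝ) : ℝ :=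
  if c = ⊤ then 1 else if c = ⊥ then 0 else stdPhi ((c.toReal - x) / s)

def truncOrdered {k : ℕ} (a b : Fin k → EReal) : Prop :=
  (∀ i, a i < b i) ∧ ∀ i j : Fin k, i < j → b i < a j

def truncSet {k : ℕ} (a b : Fin k → EReal) : Set ℝ :=
  {x : ℝ | ∃ i, a i < (x : EReal) ∧ (x : EReal) < b i}

noncomputable def truncSum {k : ℕ} (a b : Fin k → EReal) (s x : ℝ) : ℝ :=
  ∑ i, (stdPhiE (b i) x s - stdPhiE (a i) x s)

noncomputable def condPDF {k : ℕ} (a b : Fin k → EReal) (σ τ μ x : ℝ) : ℝ :=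
  (1 / σ) * stdphi ((x - μ) / σ) * truncSum a b τ x
    / truncSum a b (Real.sqrt (σ ^ 2 + τ ^ 2)) μ

noncomputable def Fmu {k : ℕ} (a b : Fin k → EReal) (σ τ μ x : ℝ) : ℝ :=
  ∫ u in Iic x, condPDF a b σ τ μ u

/-- `G_μ(x,v) = Φ((x - (ρ²μ + (1-ρ²)v))/(σρ))` with `ρ² = τ²/(σ²+τ²)`. -/
noncomputable def Gfun (σ τ μ x v : ℝ) : ℝ :=
  stdPhi ((x - (τ ^ 2 / (σ ^ 2 + τ ^ 2) * μ + (1 - τ ^ 2 / (σ ^ 2 + τ ^ 2)) * v)) /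
    (σ * Real.sqrt (τ ^ 2 / (σ ^ 2 + τ ^ 2))))

/-- `G_μ(x,v)` for an extended-real `v`, with the natural conventions at `±∞`. -/
noncomputable def GfunE (σ τ μ x : ℝ) (c : EReal) : ℝ :=
  if c = ⊤ then 0 else if c = ⊥ then 1 else Gfun σ τ μ x c.toReal

/-- `h(v)` from Lemma `le_dmu_formula`. -/
noncomputable def hfun {k : ℕ} (a b : Fin k → EReal) (σ τ μ v : ℝ) : ℝ :=
  (1 / Real.sqrt (σ ^ 2 + τ ^ 2)) * stdphi ((v - μ) / Real.sqrt (σ ^ 2 + τ ^ 2)) /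
    truncSum a b (Real.sqrt (σ ^ 2 + τ ^ 2)) μ

/-- `h(v)` for an extended-real `v`, with the convention `φ(±∞) = 0`. -/
noncomputable def hfunE {k : ℕ} (a b : Fin k → EReal) (σ τ μ : ℝ) (c : EReal) : ℝ :=
  if c = ⊤ then 0 else if c = ⊥ then 0 else hfun a b σ τ μ c.toReal

/-- `l(x,v)` from Lemma `le_dens_dx`. -/
noncomputable def lfun {k : ℕ} (a b : Fin k → EReal) (τ x v : ℝ) : ℝ :=
  (1 / τ) * stdphi ((v - x) / τ) / truncSum a b τ x

/-- `l(x,v)` for an extended-real `v`, with the convention `φ(±∞) = 0`. -/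
noncomputable def lfunE {k : ℕ} (a b : Fin k → EReal) (τ x : ℝ) (c : EReal) : ℝ :=
  if c = ⊤ then 0 else if c = ⊥ then 0 else lfun a b τ x c.toReal

/-- The function `B_μ(x)` from the proof of Proposition 1. -/
noncomputable def Bfun {k : ℕ} (a b : Fin k → EReal) (σ τ μ x : ℝ) : ℝ :=
  Real.sqrt (τ ^ 2 / (σ ^ 2 + τ ^ 2)) / σ * stdphi (stdPhiInv (Fmu a b σ τ μ x))
    - condPDF a b σ τ μ x
    + ∑ i, (hfunE a b σ τ μ (b i) * (Fmu a b σ τ μ x - GfunE σ τ μ x (b i))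
        - hfunE a b σ τ μ (a i) * (Fmu a b σ τ μ x - GfunE σ τ μ x (a i)))

/-- The density of `N(m, s²)` for `0 < s`. -/
noncomputable def normalDensity (s m x : ℝ) : ℝ := (1 / s) * stdphi ((x - m) / s)

theorem stdphi_eq : stdphi = gaussianPDFReal 0 1 := by
  ext x
  simp [stdphi, gaussianPDFReal]
  ring

theorem stdphi_pos (x : ℝ) : 0 < stdphi x := by
  rw [stdphi_eq]
  exact gaussianPDFReal_pos 0 1 x one_ne_zero

theorem integrable_stdphi : Integrable stdphi := by
  rw [stdphi_eq]
  exact integrable_gaussianPDFReal 0 1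

theorem integral_stdphi : ∫ x, stdphi x = 1 := by
  rw [stdphi_eq]
  exact integral_gaussianPDFReal_eq_one 0 one_ne_zero

theorem continuous_stdphi : Continuous stdphi := by
  unfold stdphi
  fun_prop

theorem stdphi_neg (x : ℝ) : stdphi (-x) = stdphi x := by
  simp [stdphi]

theorem stdphi_le_one (x : ℝ) : stdphi x ≤ 1 := by
  unfold stdphi
  have h : 1 ≤ √(2 * Real.pi) := by
    rw [Real.one_le_sqrt]
    linarith [Real.pi_gt_three]
  rw [div_le_one (by linarith)]
  refine le_trans (Real.exp_le_one_iff.2 ?_) h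
  nlinarith [sq_nonneg x]

theorem stdPhi_sub (x y : ℝ) : stdPhi y - stdPhi x = ∫ t in x..y, stdphi t :=
  intervalIntegral.integral_Iic_sub_Iic integrable_stdphi.integrableOn
    integrable_stdphi.integrableOn

theorem stdPhi_strictMono : StrictMono stdPhi := by
  intro x y hxy
  rw [← sub_pos, stdPhi_sub]
  exact intervalIntegral.intervalIntegral_pos_of_pos
    (continuous_stdphi.intervalIntegrable _ _) stdphi_pos hxy

theorem stdPhi_sub_le {x y : ℝ} (hxy : x ≤ y) : stdPhi y - stdPhi x ≤ y - x := by
  rw [stdPhi_sub]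
  have := intervalIntegral.integral_mono_on hxy (continuous_stdphi.intervalIntegrable _ _)
    (continuous_const.intervalIntegrable (μ := volume) x y) (fun t _ => stdphi_le_one t)
  simpa using this

theorem continuous_stdPhi : Continuous stdPhi := by
  refine LipschitzWith.continuous (K := 1) (LipschitzWith.of_le_add fun x y => ?_)
  rcases le_total x y with h | h
  · linarith [stdPhi_strictMono.monotone h, dist_nonneg (x := x) (y := y)]
  · have := stdPhi_sub_le h
    rw [Real.dist_eq]
    linarith [le_abs_self (x - y)]

theorem stdPhi_add_stdPhi_neg (x : ℝ) : stdPhi x + stdPhi (-x) = 1 := by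
  have h : stdPhi (-x) = ∫ t in Ioi x, stdphi t := by
    rw [stdPhi, ← integral_comp_neg_Ioi]
    simp [stdphi_neg]
  rw [h, stdPhi, ← integral_stdphi]
  have := integral_add_compl (measurableSet_Iic (a := x)) integrable_stdphi
  rwa [compl_Iic] at this

theorem tendsto_stdPhi_atTop : Tendsto stdPhi atTop (𝓝 1) := by
  rw [← integral_stdphi]
  exact (aecover_Iic tendsto_id).integral_tendsto_of_countably_generated integrable_stdphi

theorem tendsto_stdPhi_atBot : Tendsto stdPhi atBot (𝓝 0) := by
  have h := (tendsto_stdPhi_atTop.comp tendsto_neg_atBot_atTop).const_sub 1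
  rw [sub_self] at h
  refine h.congr fun x => ?_
  simp only [Function.comp]
  linarith [stdPhi_add_stdPhi_neg x]

theorem stdPhi_nonneg (x : ℝ) : 0 ≤ stdPhi x :=
  integral_nonneg fun t => (stdphi_pos t).le

theorem stdPhi_le_one (x : ℝ) : stdPhi x ≤ 1 := by
  linarith [stdPhi_add_stdPhi_neg x, stdPhi_nonneg (-x)]

theorem stdPhi_stdPhiInv {q : ℝ} (hq : q ∈ Ioo (0 : ℝ) 1) : stdPhi (stdPhiInv q) = q := by
  refine Function.invFun_eq ?_
  obtain ⟨x, hx⟩ := (tendsto_stdPhi_atBot.eventually_lt_const hq.1).exists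
  obtain ⟨y, hy⟩ := (tendsto_stdPhi_atTop.eventually_const_lt hq.2).exists
  exact mem_range_of_exists_le_of_exists_ge continuous_stdPhi ⟨x, hx.le⟩ ⟨y, hy.le⟩

theorem tendsto_of_tendsto_stdPhi {α : Type*} {l : Filter α} {f : α → ℝ} {y : ℝ}
    (h : Tendsto (fun t => stdPhi (f t)) l (𝓝 (stdPhi y))) : Tendsto f l (𝓝 y) := by
  refine tendsto_order.2 ⟨fun c hc => ?_, fun c hc => ?_⟩
  · filter_upwards [h.eventually_const_lt (stdPhi_strictMono hc)] with t ht
    exact stdPhi_strictMono.lt_iff_lt.1 ht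
  · filter_upwards [h.eventually_lt_const (stdPhi_strictMono hc)] with t ht
    exact stdPhi_strictMono.lt_iff_lt.1 ht

theorem normalDensity_pos {s : ℝ} (hs : 0 < s) (m x : ℝ) : 0 < normalDensity s m x :=
  mul_pos (by positivity) (stdphi_pos _)

theorem continuous_normalDensity (s : ℝ) :
    Continuous fun p : ℝ × ℝ => normalDensity s p.1 p.2 := by
  unfold normalDensity
  exact continuous_const.mul (continuous_stdphi.comp (by fun_prop))

theorem integrable_normalDensity {s : ℝ} (hs : 0 < s) (m : ℝ) :
    Integrable (normalDensity s m) :=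
  ((integrable_stdphi.comp_div hs.ne').comp_sub_right m).const_mul (1 / s)

theorem integral_normalDensity {s : ℝ} (hs : 0 < s) (m : ℝ) :
    ∫ x, normalDensity s m x = 1 := by
  simp only [normalDensity]
  rw [integral_const_mul, integral_sub_right_eq_self (fun x => stdphi (x / s)) m,
    Measure.integral_comp_div, integral_stdphi, abs_of_pos hs]
  simp [hs.ne']

theorem integral_Iic_normalDensity {s : ℝ} (hs : 0 < s) (m x : ℝ) :
    ∫ u in Iic x, normalDensity s m u = stdPhi ((x - m) / s) := by
  have h : (Iic x).indicator (normalDensity s m)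
      = fun u => (1 / s) * (Iic ((x - m) / s)).indicator stdphi ((u - m) / s) := by
    ext u
    by_cases hu : u ≤ x
    · have h' : (u - m) / s ≤ (x - m) / s := by gcongr
      simp [indicator, hu, h', normalDensity]
    · have h' : ¬ (u - m) / s ≤ (x - m) / s := by
        rw [div_le_div_iff_of_pos_right hs]
        linarith
      simp only [indicator, mem_Iic, hu, h', if_false, mul_zero]
  rw [← integral_indicator measurableSet_Iic, h, integral_const_mul,
    integral_sub_right_eq_self (fun u => (Iic ((x - m) / s)).indicator stdphi (u / s)) m,
    Measure.integral_comp_div, integral_indicator measurableSet_Iic, abs_of_pos hs, stdPhi]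
  simp [hs.ne']

/-- Conditioning a normal variable on its noisy observation: the joint density of `(X, X + U)`
factors in both orders. -/
theorem normalDensity_mul_normalDensity {σ τ ρ : ℝ} (hσ : 0 < σ) (hτ : 0 < τ) (hρ : 0 < ρ)
    (hρ2 : ρ ^ 2 = τ ^ 2 / (σ ^ 2 + τ ^ 2)) (μ u z : ℝ) :
    normalDensity σ μ u * normalDensity τ u z =
      normalDensity √(σ ^ 2 + τ ^ 2) μ z *
        normalDensity (σ * ρ) (ρ ^ 2 * μ + (1 - ρ ^ 2) * z) u := by
  have hs : 0 < σ ^ 2 + τ ^ 2 := by positivity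
  obtain ⟨s, hs0, hs2⟩ : ∃ s, 0 < s ∧ √(σ ^ 2 + τ ^ 2) = s := ⟨_, by positivity, rfl⟩
  have hss : s ^ 2 = σ ^ 2 + τ ^ 2 := by rw [← hs2, Real.sq_sqrt hs.le]
  have hρs : ρ = τ / s := by
    rw [← sq_eq_sq₀ hρ.le (by positivity), hρ2, div_pow, hss]
  have hτ2 : τ ^ 2 = s ^ 2 - σ ^ 2 := by linarith
  rw [hs2, hρs]
  simp only [normalDensity, stdphi]
  have key : Real.exp (-((u - μ) / σ) ^ 2 / 2) * Real.exp (-((z - u) / τ) ^ 2 / 2) =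
      Real.exp (-((z - μ) / s) ^ 2 / 2) *
        Real.exp (-((u - ((τ / s) ^ 2 * μ + (1 - (τ / s) ^ 2) * z)) / (σ * (τ / s))) ^ 2 / 2) := by
    rw [← Real.exp_add, ← Real.exp_add]
    congr 1
    have h1 : 1 - (τ / s) ^ 2 = σ ^ 2 / s ^ 2 := by
      field_simp
      linarith
    rw [h1]
    field_simp
    rw [← sub_eq_zero]
    have : σ ^ 2 = s ^ 2 - τ ^ 2 := by linarith
    have h4 : σ ^ 4 = (s ^ 2 - τ ^ 2) ^ 2 := by rw [← this]; ring
    ring_nf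
    simp only [h4, this]
    ring
  have hpi : √(2 * Real.pi) ≠ 0 := by positivity
  field_simp
  field_simp at key
  linear_combination key

theorem normalDensity_eq_exp_mul {s : ℝ} (hs : 0 < s) (μ z : ℝ) :
    normalDensity s μ z =
      Real.exp (-(μ ^ 2) / (2 * s ^ 2)) * Real.exp (z * μ / s ^ 2) * normalDensity s 0 z := by
  have h : Real.exp (-((z - μ) / s) ^ 2 / 2) = Real.exp (-(μ ^ 2) / (2 * s ^ 2)) *
      Real.exp (z * μ / s ^ 2) * Real.exp (-((z - 0) / s) ^ 2 / 2) := by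
    rw [← Real.exp_add, ← Real.exp_add]
    congr 1
    field_simp
    ring
  simp only [normalDensity, stdphi]
  rw [h]
  ring

theorem setIntegral_Ioi_normalDensity_pos {ν : Measure ℝ} {s β : ℝ} (hs : 0 < s)
    (hint : ∀ m, Integrable (normalDensity s m) ν) (hν : ∀ c < β, ν (Ioi c) ≠ 0)
    (m : ℝ) {c : ℝ} (hc : c < β) : 0 < ∫ z in Ioi c, normalDensity s m z ∂ν := by
  rw [setIntegral_pos_iff_support_of_nonneg_ae
    (ae_of_all _ fun z => (normalDensity_pos hs m z).le) (hint m).integrableOn]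
  have : Function.support (normalDensity s m) = univ :=
    Function.support_eq_univ fun z => (normalDensity_pos hs m z).ne'
  rw [this, univ_inter]
  exact pos_iff_ne_zero.2 (hν c hc)

theorem setIntegral_Ioi_normalDensity_le {ν : Measure ℝ} {s : ℝ} (hs : 0 < s)
    (hint : ∀ m, Integrable (normalDensity s m) ν) (m c : ℝ) :
    ∫ z in Ioi c, normalDensity s m z ∂ν ≤ ∫ z, normalDensity s m z ∂ν :=
  setIntegral_le_integral (hint m) (ae_of_all _ fun z => (normalDensity_pos hs m z).le)

theorem integral_normalDensity_pos {ν : Measure ℝ} {s β : ℝ} (hs : 0 < s)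
    (hint : ∀ m, Integrable (normalDensity s m) ν) (hν : ∀ c < β, ν (Ioi c) ≠ 0) (m : ℝ) :
    0 < ∫ z, normalDensity s m z ∂ν :=
  (setIntegral_Ioi_normalDensity_pos hs hint hν m (sub_one_lt β)).trans_le
    (setIntegral_Ioi_normalDensity_le hs hint m _)

/-- Tilting by a large mean concentrates the mass near the upper end `β` of the support. -/
theorem tendsto_setIntegral_Iic_div_integral {ν : Measure ℝ} {s β : ℝ} (hs : 0 < s)
    (hint : ∀ m, Integrable (normalDensity s m) ν) (hν : ∀ c < β, ν (Ioi c) ≠ 0)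
    {c : ℝ} (hc : c < β) :
    Tendsto (fun μ => (∫ z in Iic c, normalDensity s μ z ∂ν) / ∫ z, normalDensity s μ z ∂ν)
      atTop (𝓝 0) := by
  obtain ⟨d, hcd, hdβ⟩ := exists_between hc
  set p := ∫ z in Ioi d, normalDensity s 0 z ∂ν with hp
  set D := ∫ z, normalDensity s 0 z ∂ν with hD
  have hp0 : 0 < p := setIntegral_Ioi_normalDensity_pos hs hint hν 0 hdβ
  have hlim : Tendsto (fun μ : ℝ => Real.exp (-((d - c) / s ^ 2 * μ)) * (D / p)) atTop (𝓝 0) := by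
    have h1 : Tendsto (fun μ : ℝ => (d - c) / s ^ 2 * μ) atTop atTop :=
      tendsto_id.const_mul_atTop (div_pos (sub_pos.2 hcd) (by positivity))
    simpa using (Real.tendsto_exp_neg_atTop_nhds_zero.comp h1).mul_const (D / p)
  refine squeeze_zero' ?_ ?_ hlim
  · exact Eventually.of_forall fun μ => div_nonneg
      (integral_nonneg fun z => (normalDensity_pos hs μ z).le)
      (integral_normalDensity_pos hs hint hν μ).le
  filter_upwards [eventually_ge_atTop 0] with μ hμ
  set K := Real.exp (-(μ ^ 2) / (2 * s ^ 2)) with hK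
  have hK0 : 0 < K := Real.exp_pos _
  have hnum : ∫ z in Iic c, normalDensity s μ z ∂ν ≤ K * Real.exp (c * μ / s ^ 2) * D := by
    calc ∫ z in Iic c, normalDensity s μ z ∂ν
        ≤ ∫ z in Iic c, K * Real.exp (c * μ / s ^ 2) * normalDensity s 0 z ∂ν := by
          refine setIntegral_mono_on (hint μ).integrableOn
            ((hint 0).const_mul _).integrableOn measurableSet_Iic fun z hz => ?_
          have hz' : z ≤ c := hz
          have := (normalDensity_pos hs 0 z).le
          rw [normalDensity_eq_exp_mul hs μ z]
          gcongr
      _ = K * Real.exp (c * μ / s ^ 2) * ∫ z in Iic c, normalDensity s 0 z ∂ν :=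
          integral_const_mul _ _
      _ ≤ K * Real.exp (c * μ / s ^ 2) * D := by
          gcongr
          exact setIntegral_le_integral (hint 0)
            (ae_of_all _ fun z => (normalDensity_pos hs 0 z).le)
  have hden : K * Real.exp (d * μ / s ^ 2) * p ≤ ∫ z, normalDensity s μ z ∂ν := by
    calc K * Real.exp (d * μ / s ^ 2) * p
        = ∫ z in Ioi d, K * Real.exp (d * μ / s ^ 2) * normalDensity s 0 z ∂ν :=
          (integral_const_mul _ _).symm
      _ ≤ ∫ z in Ioi d, normalDensity s μ z ∂ν := by
          refine setIntegral_mono_on ((hint 0).const_mul _).integrableOn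
            (hint μ).integrableOn measurableSet_Ioi fun z hz => ?_
          have hz' : d < z := hz
          have := (normalDensity_pos hs 0 z).le
          rw [normalDensity_eq_exp_mul hs μ z]
          gcongr
      _ ≤ _ := setIntegral_Ioi_normalDensity_le hs hint μ d
  have hD0 : 0 < D := integral_normalDensity_pos hs hint hν 0
  calc _ ≤ (K * Real.exp (c * μ / s ^ 2) * D) / (K * Real.exp (d * μ / s ^ 2) * p) := by
        gcongr
    _ = Real.exp (-((d - c) / s ^ 2 * μ)) * (D / p) := by
        have : Real.exp (c * μ / s ^ 2) =
            Real.exp (-((d - c) / s ^ 2 * μ)) * Real.exp (d * μ / s ^ 2) := by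
          rw [← Real.exp_add]
          congr 1
          ring
        rw [this]
        field_simp

/-- The c.d.f. of `X` given `X + U ∈ T`, as a mixture of normal c.d.f.s over the value of
`X + U`. -/
theorem integral_Iic_mul_integral_normalDensity {ν : Measure ℝ} [SFinite ν] {σ τ ρ : ℝ}
    (hσ : 0 < σ) (hτ : 0 < τ) (hρ : 0 < ρ) (hρ2 : ρ ^ 2 = τ ^ 2 / (σ ^ 2 + τ ^ 2))
    (hint : ∀ m, Integrable (normalDensity √(σ ^ 2 + τ ^ 2) m) ν) (μ x : ℝ) :
    ∫ u in Iic x, normalDensity σ μ u * ∫ z, normalDensity τ u z ∂ν =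
      ∫ z, normalDensity √(σ ^ 2 + τ ^ 2) μ z *
        stdPhi ((x - (ρ ^ 2 * μ + (1 - ρ ^ 2) * z)) / (σ * ρ)) ∂ν := by
  have hσρ : 0 < σ * ρ := mul_pos hσ hρ
  have hs : 0 < √(σ ^ 2 + τ ^ 2) := by positivity
  have hf : Integrable (Function.uncurry fun z u => normalDensity √(σ ^ 2 + τ ^ 2) μ z *
      normalDensity (σ * ρ) (ρ ^ 2 * μ + (1 - ρ ^ 2) * z) u)
      (ν.prod (volume.restrict (Iic x))) := by
    have hcont : Continuous (Function.uncurry fun z u => normalDensity √(σ ^ 2 + τ ^ 2) μ z *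
        normalDensity (σ * ρ) (ρ ^ 2 * μ + (1 - ρ ^ 2) * z) u) :=
      ((continuous_normalDensity _).comp (f := fun p : ℝ × ℝ => (μ, p.1)) (by fun_prop)).mul
        ((continuous_normalDensity _).comp
          (f := fun p : ℝ × ℝ => (ρ ^ 2 * μ + (1 - ρ ^ 2) * p.1, p.2)) (by fun_prop))
    refine Integrable.mono_measure (ν := ν.prod volume) ?_
      (Measure.prod_mono le_rfl Measure.restrict_le_self)
    rw [integrable_prod_iff hcont.aestronglyMeasurable]
    refine ⟨ae_of_all _ fun z =>
      (integrable_normalDensity hσρ (ρ ^ 2 * μ + (1 - ρ ^ 2) * z)).const_mul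
        (normalDensity √(σ ^ 2 + τ ^ 2) μ z), ?_⟩
    refine (hint μ).congr (ae_of_all _ fun z => ?_)
    have : ∀ u, ‖normalDensity √(σ ^ 2 + τ ^ 2) μ z *
        normalDensity (σ * ρ) (ρ ^ 2 * μ + (1 - ρ ^ 2) * z) u‖ =
          normalDensity √(σ ^ 2 + τ ^ 2) μ z *
            normalDensity (σ * ρ) (ρ ^ 2 * μ + (1 - ρ ^ 2) * z) u := fun u =>
      Real.norm_of_nonneg
        (mul_pos (normalDensity_pos hs μ z) (normalDensity_pos hσρ _ u)).le
    simp only [Function.uncurry, this]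
    rw [integral_const_mul, integral_normalDensity hσρ, mul_one]
  simp_rw [← integral_const_mul, normalDensity_mul_normalDensity hσ hτ hρ hρ2]
  rw [← integral_integral_swap hf]
  simp_rw [integral_const_mul, integral_Iic_normalDensity hσρ]

theorem le_mixture_of_ae_le {ν : Measure ℝ} {s β : ℝ} (hs : 0 < s)
    (hint : ∀ m, Integrable (normalDensity s m) ν) (hν : ∀ c < β, ν (Ioi c) ≠ 0)
    (hβ : ∀ᵐ z ∂ν, z ≤ β) {g : ℝ → ℝ} (hg : Antitone g) (hg0 : ∀ z, 0 ≤ g z)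
    (hg1 : ∀ z, g z ≤ 1) (μ : ℝ) :
    g β ≤ (∫ z, normalDensity s μ z * g z ∂ν) / ∫ z, normalDensity s μ z ∂ν := by
  rw [le_div_iff₀ (integral_normalDensity_pos hs hint hν μ), mul_comm, ← integral_mul_const]
  refine integral_mono_ae ((hint μ).mul_const _) ?_ ?_
  · refine (hint μ).mul_bdd (c := 1) hg.measurable.aestronglyMeasurable (ae_of_all _ fun z => ?_)
    rw [Real.norm_of_nonneg (hg0 z)]
    exact hg1 z
  · filter_upwards [hβ] with z hz
    exact mul_le_mul_of_nonneg_left (hg hz) (normalDensity_pos hs μ z).le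

theorem mixture_le {ν : Measure ℝ} {s β : ℝ} (hs : 0 < s)
    (hint : ∀ m, Integrable (normalDensity s m) ν) (hν : ∀ c < β, ν (Ioi c) ≠ 0)
    {g : ℝ → ℝ} (hg : Antitone g) (hg0 : ∀ z, 0 ≤ g z) (hg1 : ∀ z, g z ≤ 1) (μ c : ℝ) :
    (∫ z, normalDensity s μ z * g z ∂ν) / ∫ z, normalDensity s μ z ∂ν ≤
      g c + (∫ z in Iic c, normalDensity s μ z ∂ν) / ∫ z, normalDensity s μ z ∂ν := by
  have hD := integral_normalDensity_pos hs hint hν μ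
  rw [div_le_iff₀ hD, add_mul, div_mul_cancel₀ _ hD.ne', mul_comm (g c), ← integral_mul_const,
    ← integral_indicator measurableSet_Iic,
    ← integral_add ((hint μ).mul_const _) ((hint μ).indicator measurableSet_Iic)]
  refine integral_mono ?_ (((hint μ).mul_const _).add ((hint μ).indicator measurableSet_Iic))
    fun z => ?_
  · refine (hint μ).mul_bdd (c := 1) hg.measurable.aestronglyMeasurable (ae_of_all _ fun z => ?_)
    rw [Real.norm_of_nonneg (hg0 z)]
    exact hg1 z
  · have h := normalDensity_pos hs μ z
    by_cases hz : z ≤ c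
    · simp only [indicator, mem_Iic, hz, if_true]
      nlinarith [mul_le_mul_of_nonneg_left (hg1 z) h.le, mul_nonneg h.le (hg0 c)]
    · simp only [indicator, mem_Iic, hz, if_false, add_zero]
      exact mul_le_mul_of_nonneg_left (hg (not_le.1 hz).le) h.le

/-- Lebesgue measure on the truncation set. -/
noncomputable def truncMeasure {k : ℕ} (a b : Fin k → EReal) : Measure ℝ :=
  ∑ i, volume.restrict {z : ℝ | a i < z ∧ (z : EReal) ≤ b i}

instance {k : ℕ} (a b : Fin k → EReal) : SFinite (truncMeasure a b) := by
  unfold truncMeasure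
  rw [← Measure.sum_fintype]
  infer_instance

theorem measurableSet_coe_le (c : EReal) : MeasurableSet {z : ℝ | (z : EReal) ≤ c} :=
  measurableSet_le measurable_coe_real_ereal measurable_const

theorem stdPhiE_eq_setIntegral (c : EReal) {s : ℝ} (hs : 0 < s) (x : ℝ) :
    stdPhiE c x s = ∫ z in {z : ℝ | (z : EReal) ≤ c}, normalDensity s x z := by
  induction c with
  | bot => simp [stdPhiE]
  | top => simp [stdPhiE, integral_normalDensity hs]
  | coe c =>
    have : {z : ℝ | (z : EReal) ≤ c} = Iic c := by
      ext z
      simp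
    rw [this, integral_Iic_normalDensity hs]
    simp [stdPhiE]

theorem stdPhiE_sub_stdPhiE {c d : EReal} (hcd : c ≤ d) {s : ℝ} (hs : 0 < s) (x : ℝ) :
    stdPhiE d x s - stdPhiE c x s =
      ∫ z in {z : ℝ | c < z ∧ (z : EReal) ≤ d}, normalDensity s x z := by
  have hdiff : {z : ℝ | c < z ∧ (z : EReal) ≤ d} =
      {z : ℝ | (z : EReal) ≤ d} \ {z : ℝ | (z : EReal) ≤ c} := by
    ext z
    simp [and_comm]
  rw [hdiff, stdPhiE_eq_setIntegral _ hs, stdPhiE_eq_setIntegral _ hs,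
    setIntegral_sdiff (measurableSet_coe_le c) (integrable_normalDensity hs x).integrableOn]
  exact fun z hz => le_trans hz hcd

theorem integrable_normalDensity_truncMeasure {k : ℕ} (a b : Fin k → EReal) {s : ℝ} (hs : 0 < s)
    (m : ℝ) : Integrable (normalDensity s m) (truncMeasure a b) :=
  integrable_finsetSum_measure.2 fun _ _ => (integrable_normalDensity hs m).integrableOn

theorem truncSum_eq_integral {k : ℕ} {a b : Fin k → EReal} (hab : ∀ i, a i < b i) {s : ℝ}
    (hs : 0 < s) (x : ℝ) :
    truncSum a b s x = ∫ z, normalDensity s x z ∂truncMeasure a b := by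
  rw [truncMeasure, integral_finsetSum_measure
    fun _ _ => (integrable_normalDensity hs x).integrableOn]
  exact Finset.sum_congr rfl fun i _ => stdPhiE_sub_stdPhiE (hab i).le hs x

theorem truncOrdered.le_last {k : ℕ} {a b : Fin (k + 1) → EReal} (hab : truncOrdered a b)
    (i : Fin (k + 1)) : b i ≤ b (Fin.last k) := by
  rcases (Fin.le_last i).eq_or_lt with h | h
  · rw [h]
  · exact ((hab.2 i _ h).trans (hab.1 _)).le

theorem ae_truncMeasure_le {k : ℕ} {a b : Fin (k + 1) → EReal} (hab : truncOrdered a b)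
    {β : ℝ} (hβ : b (Fin.last k) = β) : ∀ᵐ z ∂truncMeasure a b, z ≤ β := by
  rw [truncMeasure, ← Measure.sum_fintype, Measure.ae_sum_iff]
  intro i
  have hm : MeasurableSet {z : ℝ | a i < z ∧ (z : EReal) ≤ b i} :=
    (measurableSet_lt measurable_const measurable_coe_real_ereal).inter
      (measurableSet_coe_le _)
  filter_upwards [ae_restrict_mem hm] with z hz
  have := hz.2.trans (hab.le_last i)
  rw [hβ] at this
  exact_mod_cast this

theorem truncMeasure_Ioi_ne_zero {k : ℕ} {a b : Fin (k + 1) → EReal} (hab : truncOrdered a b)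
    {β : ℝ} (hβ : b (Fin.last k) = β) {c : ℝ} (hc : c < β) :
    truncMeasure a b (Ioi c) ≠ 0 := by
  have hlt : a (Fin.last k) < β := hβ ▸ hab.1 (Fin.last k)
  obtain ⟨d, had, hdβ⟩ := EReal.lt_iff_exists_real_btwn.1 hlt
  have hdβ' : d < β := by exact_mod_cast hdβ
  have hsub : Ioc (max c d) β ⊆
      Ioi c ∩ {z : ℝ | a (Fin.last k) < z ∧ (z : EReal) ≤ b (Fin.last k)} := by
    intro z hz
    have hdz : d < z := (le_max_right c d).trans_lt hz.1
    refine ⟨(le_max_left c d).trans_lt hz.1, had.trans (by exact_mod_cast hdz), ?_⟩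
    rw [hβ]
    exact_mod_cast hz.2
  have hpos : 0 < volume (Ioc (max c d) β) := by
    simp [hc, hdβ']
  have hle : volume (Ioc (max c d) β) ≤ truncMeasure a b (Ioi c) := by
    refine (measure_mono hsub).trans ?_
    rw [← Measure.restrict_apply measurableSet_Ioi, truncMeasure, Measure.finsetSum_apply]
    exact Finset.single_le_sum
      (f := fun i => volume.restrict {z : ℝ | a i < z ∧ (z : EReal) ≤ b i} (Ioi c))
      (fun _ _ => zero_le) (Finset.mem_univ (Fin.last k))
  exact (hpos.trans_le hle).ne'

theorem Fmu_eq_mixture {k : ℕ} {a b : Fin k → EReal} (hab : ∀ i, a i < b i) {σ τ ρ : ℝ}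
    (hσ : 0 < σ) (hτ : 0 < τ) (hρ : 0 < ρ) (hρ2 : ρ ^ 2 = τ ^ 2 / (σ ^ 2 + τ ^ 2)) (μ x : ℝ) :
    Fmu a b σ τ μ x =
      (∫ z, normalDensity √(σ ^ 2 + τ ^ 2) μ z *
        stdPhi ((x - (ρ ^ 2 * μ + (1 - ρ ^ 2) * z)) / (σ * ρ)) ∂truncMeasure a b) /
        ∫ z, normalDensity √(σ ^ 2 + τ ^ 2) μ z ∂truncMeasure a b := by
  have hs : 0 < √(σ ^ 2 + τ ^ 2) := by positivity
  rw [← integral_Iic_mul_integral_normalDensity hσ hτ hρ hρ2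
    (integrable_normalDensity_truncMeasure a b hs), ← integral_div, Fmu]
  simp only [condPDF, truncSum_eq_integral hab hs, truncSum_eq_integral hab hτ, normalDensity]

/-- The quantile `μ_q(x)`, centred and scaled, tends to `Φ⁻¹(1 - q)` as `x → ∞`. -/
theorem tendsto_quantile {k : ℕ} {a b : Fin (k + 1) → EReal} (hab : truncOrdered a b)
    {β : ℝ} (hβ : b (Fin.last k) = β) {σ τ ρ : ℝ} (hσ : 0 < σ) (hτ : 0 < τ)
    (hρ : 0 < ρ) (hρ2 : ρ ^ 2 = τ ^ 2 / (σ ^ 2 + τ ^ 2)) {m : ℝ → ℝ} {q : ℝ}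
    (hq : q ∈ Ioo (0 : ℝ) 1) (hm : ∀ x, Fmu a b σ τ (m x) x = 1 - q) :
    Tendsto (fun x => (x - (ρ ^ 2 * m x + (1 - ρ ^ 2) * β)) / (σ * ρ)) atTop
      (𝓝 (-stdPhiInv q)) := by
  have hs : 0 < √(σ ^ 2 + τ ^ 2) := by positivity
  have hσρ : 0 < σ * ρ := mul_pos hσ hρ
  have hρ1 : 0 < 1 - ρ ^ 2 := by
    rw [hρ2, sub_pos, div_lt_one (by positivity)]
    linarith [pow_pos hσ 2]
  have hint := fun m => integrable_normalDensity_truncMeasure a b hs m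
  have hν := fun c (hc : c < β) => truncMeasure_Ioi_ne_zero hab hβ hc
  have hanti : ∀ μ x, Antitone fun z =>
      stdPhi ((x - (ρ ^ 2 * μ + (1 - ρ ^ 2) * z)) / (σ * ρ)) := fun μ x z w hzw =>
    stdPhi_strictMono.monotone (by gcongr)
  set y : ℝ → ℝ := fun x => (x - (ρ ^ 2 * m x + (1 - ρ ^ 2) * β)) / (σ * ρ) with hy
  have hquant : stdPhi (-stdPhiInv q) = 1 - q := by
    linarith [stdPhi_add_stdPhi_neg (stdPhiInv q), stdPhi_stdPhiInv hq]
  have hupper : ∀ x, stdPhi (y x) ≤ 1 - q := fun x => by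
    rw [← hm x, Fmu_eq_mixture hab.1 hσ hτ hρ hρ2]
    exact le_mixture_of_ae_le hs hint hν (ae_truncMeasure_le hab hβ) (hanti (m x) x)
      (fun _ => stdPhi_nonneg _) (fun _ => stdPhi_le_one _) (m x)
  have hm_top : Tendsto m atTop atTop := by
    have hle : ∀ x, (x - ((1 - ρ ^ 2) * β - stdPhiInv q * (σ * ρ))) / ρ ^ 2 ≤ m x := fun x => by
      have h := hupper x
      rw [← hquant, stdPhi_strictMono.le_iff_le, hy, div_le_iff₀ hσρ] at h
      rw [div_le_iff₀ (by positivity)]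
      linarith
    refine tendsto_atTop_mono hle (Tendsto.atTop_div_const (by positivity) ?_)
    exact tendsto_atTop_add_const_right atTop _ tendsto_id
  refine tendsto_of_tendsto_stdPhi ?_
  rw [hquant]
  refine tendsto_order.2 ⟨fun r hr => ?_, fun r hr =>
    Eventually.of_forall fun x => (hupper x).trans_lt hr⟩
  set ε := 1 - q - r with hε
  have hε0 : 0 < ε := by linarith
  set δ := ε / 2 * (σ * ρ) / (1 - ρ ^ 2) with hδ
  have hδ0 : 0 < δ := by positivity
  have hconc := (tendsto_setIntegral_Iic_div_integral hs hint hν (sub_lt_self β hδ0)).comp hm_top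
  filter_upwards [hconc.eventually_lt_const (half_pos hε0)] with x hx
  have hmix := mixture_le hs hint hν (hanti (m x) x) (fun _ => stdPhi_nonneg _)
    (fun _ => stdPhi_le_one _) (m x) (β - δ)
  rw [← Fmu_eq_mixture hab.1 hσ hτ hρ hρ2, hm x] at hmix
  have hshift : (x - (ρ ^ 2 * m x + (1 - ρ ^ 2) * (β - δ))) / (σ * ρ) = y x + ε / 2 := by
    simp only [hy, hδ]
    field_simp
    ring
  simp only [hshift] at hmix
  simp only [Function.comp] at hx
  have := stdPhi_sub_le (x := y x) (y := y x + ε / 2) (by linarith)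
  linarith

/-- Theorem 1 (sharpness as `x → ∞` when `sup T = bₖ < ∞`). -/
theorem stmt1 {k : ℕ} (a b : Fin (k + 1) → EReal) (hab : truncOrdered a b)
    (hbk : b (Fin.last k) ≠ ⊤)
    (σ τ ρ : ℝ) (hσ : 0 < σ) (hτ : 0 < τ)
    (hρ : 0 < ρ) (hρ2 : ρ ^ 2 = τ ^ 2 / (σ ^ 2 + τ ^ 2))
    (μq : ℝ → ℝ → ℝ)
    (hμq : ∀ q ∈ Ioo (0 : ℝ) 1, ∀ x : ℝ, Fmu a b σ τ (μq q x) x = 1 - q)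
    (q₁ q₂ : ℝ) (hq₁ : q₁ ∈ Ioo (0 : ℝ) 1) (hq₂ : q₂ ∈ Ioo (0 : ℝ) 1)
    (hq : q₁ < q₂) :
    Tendsto (fun x => μq q₂ x - μq q₁ x) atTop
      (𝓝 (σ / ρ * (stdPhiInv q₂ - stdPhiInv q₁))) := by
  obtain ⟨β, hβ⟩ : ∃ β : ℝ, b (Fin.last k) = β :=
    ⟨_, (EReal.coe_toReal hbk (bot_le.trans_lt (hab.1 _)).ne').symm⟩
  have h₁ := tendsto_quantile hab hβ hσ hτ hρ hρ2 hq₁ (hμq q₁ hq₁)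
  have h₂ := tendsto_quantile hab hβ hσ hτ hρ hρ2 hq₂ (hμq q₂ hq₂)
  have h := (h₁.sub h₂).const_mul (σ / ρ)
  rw [show -stdPhiInv q₁ - -stdPhiInv q₂ = stdPhiInv q₂ - stdPhiInv q₁ by ring] at h
  refine h.congr fun x => ?_
  field_simp
  ring
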